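/- arXiv:2008.03544 — 3 statements merged into one kernel-verified Lean document; each statement's English description precedes it below -/
import Mathlib

section
/- Under the conditions of Theorem 1 (connected graph, positive symmetric weights, Λ p* = c·1_n, and |κ| small enough that all nonzero eigenvalues of L - κΛ have positive real part), every solution p(t) of ṗ = -(L - κΛ)p + L p* satisfies p(t) - (c₁ 1_n + p* + (κ Λ p*) t) → 0 as t → ∞ for some constant c₁ depending on p(0), i.e., the agents converge to the desired shape translating with constant velocity κ c. -/
open Matrix Filter Topology

noncomputable def inc (n e : ℕ) (tl hd : Fin e → Fin n) : Matrix (Fin n) (Fin e) ℝ :=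
  Matrix.of fun i k => if i = tl k then 1 else if i = hd k then -1 else 0

def Conn (n e : ℕ) (tl hd : Fin e → Fin n) : Prop :=
  ∀ i j : Fin n, Relation.ReflTransGen
    (fun a b => ∃ k, (tl k = a ∧ hd k = b) ∨ (tl k = b ∧ hd k = a)) i j

section LinearFlow

variable {E : Type*} [NormedAddCommGroup E] [NormedSpace ℂ E]

theorem tendsto_zero_of_hasDerivAt_neg_smul_add {μ : ℂ} (hμ : 0 < μ.re) {u g : ℝ → E}
    (hu : ∀ t, HasDerivAt u (-(μ • u t) + g t) t) (hg : Tendsto g atTop (𝓝 0)) :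
    Tendsto u atTop (𝓝 0) := by
  have hexp : ∀ t : ℝ, HasDerivAt (fun s : ℝ => Complex.exp (μ * s)) (Complex.exp (μ * t) * μ) t :=
    fun t => by simpa using ((Complex.ofRealCLM.hasDerivAt (x := t)).const_mul μ).cexp
  have hw : ∀ t : ℝ, HasDerivAt (fun s : ℝ => Complex.exp (μ * s) • u s)
      (Complex.exp (μ * t) • g t) t := fun t =>
    ((hexp t).smul (hu t)).congr_deriv (by module)
  have hnorm : ∀ t : ℝ, ‖Complex.exp (μ * t)‖ = Real.exp (μ.re * t) := fun t => by
    simp [Complex.norm_exp]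
  rw [Metric.tendsto_atTop]
  intro ε hε
  obtain ⟨T, hT⟩ := Metric.tendsto_atTop.1 hg (ε / 2 * μ.re) (by positivity)
  have hbound : ∀ t, T ≤ t → ‖u t‖ ≤
      Real.exp (-(μ.re * t)) * ‖Complex.exp (μ * T) • u T‖ + ε / 2 := by
    intro t ht
    have hB : ∀ x : ℝ, HasDerivAt (fun s : ℝ => ‖Complex.exp (μ * T) • u T‖
        + ε / 2 * (Real.exp (μ.re * s) - Real.exp (μ.re * T)))
        (ε / 2 * (Real.exp (μ.re * x) * μ.re)) x := fun x => by
      simpa using ((((hasDerivAt_id x).const_mul μ.re).exp.sub_const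
        (Real.exp (μ.re * T))).const_mul (ε / 2)).const_add ‖Complex.exp (μ * T) • u T‖
    have key := image_norm_le_of_norm_deriv_right_le_deriv_boundary
      (f := fun s : ℝ => Complex.exp (μ * s) • u s) (a := T) (b := t)
      (fun x _ => (hw x).continuousAt.continuousWithinAt)
      (fun x _ => (hw x).hasDerivWithinAt) (by simp) hB
      (fun x hx => by
        have := hT x hx.1
        rw [dist_zero_right] at this
        rw [norm_smul, hnorm]
        nlinarith [Real.exp_pos (μ.re * x)]) (Set.right_mem_Icc.2 ht)
    rw [norm_smul, hnorm] at key
    have h1 : Real.exp (-(μ.re * t)) * Real.exp (μ.re * t) = 1 := by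
      rw [← Real.exp_add]; simp
    calc ‖u t‖ = Real.exp (-(μ.re * t)) * (Real.exp (μ.re * t) * ‖u t‖) := by
          rw [← mul_assoc, h1, one_mul]
      _ ≤ Real.exp (-(μ.re * t)) * (‖Complex.exp (μ * T) • u T‖
          + ε / 2 * (Real.exp (μ.re * t) - Real.exp (μ.re * T))) := by gcongr
      _ = Real.exp (-(μ.re * t)) * ‖Complex.exp (μ * T) • u T‖
          + ε / 2 * (Real.exp (-(μ.re * t)) * Real.exp (μ.re * t))
          - ε / 2 * (Real.exp (-(μ.re * t)) * Real.exp (μ.re * T)) := by ring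
      _ ≤ _ := by
          rw [h1]
          have : 0 < ε / 2 * (Real.exp (-(μ.re * t)) * Real.exp (μ.re * T)) := by positivity
          linarith
  have hlim : Tendsto (fun t : ℝ => Real.exp (-(μ.re * t)) * ‖Complex.exp (μ * T) • u T‖)
      atTop (𝓝 0) := by
    simpa using (Real.tendsto_exp_neg_atTop_nhds_zero.comp
      (tendsto_id.const_mul_atTop hμ)).mul_const ‖Complex.exp (μ * T) • u T‖
  obtain ⟨S, hS⟩ := Filter.eventually_atTop.1 (hlim.eventually (gt_mem_nhds (half_pos hε)))
  refine ⟨max S T, fun t ht => ?_⟩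
  rw [dist_zero_right]
  linarith [hS t (le_of_max_le_left ht), hbound t (le_of_max_le_right ht)]

theorem Module.End.commute_aeval (T : Module.End ℂ E) (P : Polynomial ℂ) :
    Commute T (Polynomial.aeval T P) := by
  simpa using Polynomial.commute_X P |>.map (Polynomial.aeval T)

variable [FiniteDimensional ℂ E]

theorem Module.End.hasDerivAt_comp_of_commute {T S : Module.End ℂ E} (hTS : Commute T S)
    {u : ℝ → E} (hu : ∀ t, HasDerivAt u (-(T (u t))) t) (t : ℝ) :
    HasDerivAt (fun s => S (u s)) (-(T (S (u t)))) t := by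
  have h := ((LinearMap.toContinuousLinearMap S).restrictScalars ℝ).hasFDerivAt.comp_hasDerivAt t
    (hu t)
  have hc : T (S (u t)) = S (T (u t)) := LinearMap.congr_fun hTS.eq (u t)
  rw [hc, ← map_neg]
  exact h

theorem Module.End.tendsto_zero_of_aeval_prod_tendsto_zero (T : Module.End ℂ E)
    (s : Multiset ℂ) (hs : ∀ μ ∈ s, 0 < μ.re) {u : ℝ → E}
    (hu : ∀ t, HasDerivAt u (-(T (u t))) t)
    (h : Tendsto (fun t => Polynomial.aeval T
      (s.map fun a => Polynomial.X - Polynomial.C a).prod (u t)) atTop (𝓝 0)) :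
    Tendsto u atTop (𝓝 0) := by
  induction s using Multiset.induction_on with
  | empty => simpa using h
  | cons a s ih =>
    refine ih (fun μ hμ => hs μ (Multiset.mem_cons_of_mem hμ)) ?_
    set S := Polynomial.aeval T (s.map fun a => Polynomial.X - Polynomial.C a).prod with hS
    have hv := hasDerivAt_comp_of_commute (T.commute_aeval _ : Commute T S) hu
    refine tendsto_zero_of_hasDerivAt_neg_smul_add (μ := a) (hs a (Multiset.mem_cons_self a s))
      (g := fun t => -(T (S (u t)) - a • S (u t))) (fun t => ?_) ?_
    · convert hv t using 1
      module
    · simpa [← hS, Algebra.algebraMap_eq_smul_one] using h.neg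

/-- If zero is a simple eigenvalue of `T` and the other eigenvalues have positive real part, then
the solutions of `u' = -T u` converge to elements of the kernel of `T`. -/
theorem Module.End.exists_tendsto_of_hasDerivAt_neg (T : Module.End ℂ E)
    (hsimple : T.charpoly.rootMultiplicity 0 = 1)
    (hspec : ∀ μ ∈ T.charpoly.roots, μ ≠ 0 → 0 < μ.re) {u : ℝ → E}
    (hu : ∀ t, HasDerivAt u (-(T (u t))) t) :
    ∃ v, T v = 0 ∧ Tendsto u atTop (𝓝 v) := by
  rw [← Polynomial.count_roots] at hsimple
  have h0 : (0 : ℂ) ∈ T.charpoly.roots := Multiset.count_pos.1 (by omega)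
  obtain ⟨s, hs⟩ := Multiset.exists_cons_of_mem h0
  have hs0 : (0 : ℂ) ∉ s := by
    rw [hs, Multiset.count_cons_self] at hsimple
    exact Multiset.count_eq_zero.1 (by omega)
  set g := (s.map fun a => Polynomial.X - Polynomial.C a).prod with hg
  have hchar : T.charpoly = Polynomial.X * g := by
    rw [(IsAlgClosed.splits T.charpoly).eq_prod_roots_of_monic T.charpoly_monic, hs]
    simp [hg]
  have hTg : ∀ x, T (Polynomial.aeval T g x) = 0 := fun x => by
    have := LinearMap.congr_fun T.aeval_self_charpoly x
    rw [hchar] at this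
    simpa using this
  have hgT : ∀ x, Polynomial.aeval T g (T x) = 0 := fun x => by
    rw [← hTg x]
    exact (LinearMap.congr_fun (T.commute_aeval g).eq x).symm
  have hTu : Tendsto (fun t => T (u t)) atTop (𝓝 0) := by
    refine T.tendsto_zero_of_aeval_prod_tendsto_zero s (fun μ hμ => hspec μ ?_ ?_)
      (hasDerivAt_comp_of_commute (Commute.refl T) hu) ?_
    · rw [hs]; exact Multiset.mem_cons_of_mem hμ
    · rintro rfl; exact hs0 hμ
    · simp [← hg, hgT]
  have hconst : ∀ t, Polynomial.aeval T g (u t) = Polynomial.aeval T g (u 0) := fun t => by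
    have hd : ∀ t, HasDerivAt (fun t => Polynomial.aeval T g (u t)) 0 t := fun t => by
      simpa [hTg] using hasDerivAt_comp_of_commute (T.commute_aeval g) hu t
    exact is_const_of_deriv_eq_zero (fun t => (hd t).differentiableAt) (fun t => (hd t).deriv) t 0
  have hc : g.coeff 0 ≠ 0 := by
    rw [Polynomial.coeff_zero_eq_eval_zero, hg, Polynomial.eval_multiset_prod]
    simpa [Multiset.prod_eq_zero_iff] using hs0
  have hsplit : ∀ t, u t = (g.coeff 0)⁻¹ • (Polynomial.aeval T g (u 0)
      - Polynomial.aeval T g.divX (T (u t))) := fun t => by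
    have h1 : Polynomial.aeval T g (u t) =
        Polynomial.aeval T g.divX (T (u t)) + g.coeff 0 • u t := by
      conv_lhs => rw [← Polynomial.divX_mul_X_add g]
      simp [Algebra.algebraMap_eq_smul_one]
    rw [← hconst t, h1, add_sub_cancel_left, inv_smul_smul₀ hc]
  refine ⟨(g.coeff 0)⁻¹ • Polynomial.aeval T g (u 0), by rw [map_smul, hTg, smul_zero], ?_⟩
  have hcont : Continuous (Polynomial.aeval T g.divX) := LinearMap.continuous_of_finiteDimensional _
  have h2 := (hcont.tendsto 0).comp hTu
  rw [map_zero] at h2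
  have h3 := (h2.const_sub (Polynomial.aeval T g (u 0))).const_smul (g.coeff 0)⁻¹
  rw [sub_zero] at h3
  exact h3.congr fun t => (hsplit t).symm

end LinearFlow

theorem Module.End.exists_smul_of_mem_ker {E : Type*} [AddCommGroup E] [Module ℂ E]
    [FiniteDimensional ℂ E] (T : Module.End ℂ E)
    (hsimple : T.charpoly.rootMultiplicity 0 = 1) {x v : E} (hx : T x = 0) (hx0 : x ≠ 0)
    (hv : T v = 0) : ∃ a : ℂ, a • x = v := by
  have hfin := LinearMap.finrank_maxGenEigenspace_eq T (0 : ℂ)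
  rw [hsimple] at hfin
  have hmem : ∀ y, T y = 0 → y ∈ T.maxGenEigenspace 0 := fun y hy =>
    (T.mem_maxGenEigenspace 0 y).2 ⟨1, by simp [hy]⟩
  obtain ⟨a, ha⟩ := exists_smul_eq_of_finrank_eq_one hfin
    (x := ⟨x, hmem x hx⟩) (by simpa using hx0) ⟨v, hmem v hv⟩
  exact ⟨a, congrArg Subtype.val ha⟩

/-- If zero is a simple eigenvalue of the real matrix `A`, with eigenvector `x`, and the other
eigenvalues have positive real part, then the solutions of `q' = -A q` converge to multiples
of `x`. -/
theorem Matrix.exists_tendsto_smul_of_hasDerivAt_neg {ι : Type*} [Fintype ι] [DecidableEq ι]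
    (A : Matrix ι ι ℝ)
    (hsimple : (A.map Complex.ofReal).charpoly.rootMultiplicity 0 = 1)
    (hspec : ∀ μ ∈ (A.map Complex.ofReal).charpoly.roots, μ ≠ 0 → 0 < μ.re)
    {x : ι → ℝ} (hx : A *ᵥ x = 0) (hx0 : x ≠ 0) {q : ℝ → ι → ℝ}
    (hq : ∀ t, HasDerivAt q (-(A *ᵥ q t)) t) :
    ∃ a : ℝ, Tendsto q atTop (𝓝 (a • x)) := by
  have hmap : ∀ y : ι → ℝ, Matrix.toLin' (A.map Complex.ofReal) (fun i => (y i : ℂ)) =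
      fun i => ((A *ᵥ y) i : ℂ) := fun y => by
    ext i
    simp [Matrix.mulVec, dotProduct]
  rw [← Matrix.charpoly_toLin'] at hsimple hspec
  obtain ⟨v, hv, hlim⟩ := Module.End.exists_tendsto_of_hasDerivAt_neg
    (Matrix.toLin' (A.map Complex.ofReal)) hsimple hspec (u := fun t i => (q t i : ℂ))
    (fun t => by
      rw [hmap, hasDerivAt_pi]
      intro i
      simpa using (hasDerivAt_pi.1 (hq t) i).ofReal_comp)
  obtain ⟨a, rfl⟩ := Module.End.exists_smul_of_mem_ker _ hsimple
    (x := fun i => (x i : ℂ)) (by rw [hmap, hx]; ext; simp)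
    (fun h => hx0 (by ext i; simpa using congrFun h i)) hv
  refine ⟨a.re, tendsto_pi_nhds.2 fun i => ?_⟩
  have h := (Complex.continuous_re.tendsto _).comp (tendsto_pi_nhds.1 hlim i)
  simpa [Function.comp_def] using h

theorem inc_transpose_mulVec_one {n e : ℕ} {tl hd : Fin e → Fin n}
    (hloop : ∀ k, tl k ≠ hd k) : (inc n e tl hd)ᵀ *ᵥ (1 : Fin n → ℝ) = 0 := by
  ext k
  have h : ∀ i, inc n e tl hd i k = (if i = tl k then 1 else 0) - if i = hd k then 1 else 0 := by
    intro i
    have := hloop k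
    simp only [inc, Matrix.of_apply]
    grind
  simp [Matrix.mulVec, dotProduct, h]

/-- Under connectivity, positive weights, the design condition `Λ p* = c • 1ₙ`,
and `|κ|` small enough that `L - κΛ` has a simple zero eigenvalue (eigenvector
`1ₙ`) with all other eigenvalues of positive real part, every solution of
`ṗ = -(L - κΛ) p + L p*` converges to `c₁ 1ₙ + p* + (κ Λ p*) t`. -/
theorem stmt5 (n e : ℕ) (hn : 2 ≤ n) (tl hd : Fin e → Fin n) (hloop : ∀ k, tl k ≠ hd k)
    (hconn : Conn n e tl hd) (w : Fin e → ℝ) (hw : ∀ k, 0 < w k)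
    (M : Matrix (Fin n) (Fin e) ℝ) (pstar : Fin n → ℝ) (κ c : ℝ)
    (hdesign : (M * (inc n e tl hd)ᵀ) *ᵥ pstar = c • (1 : Fin n → ℝ))
    (hsimple : Polynomial.rootMultiplicity (0:ℂ)
      (Matrix.charpoly ((inc n e tl hd * Matrix.diagonal w * (inc n e tl hd)ᵀ
        - κ • (M * (inc n e tl hd)ᵀ)).map Complex.ofReal)) = 1)
    (hspec : ∀ μ ∈ (Matrix.charpoly ((inc n e tl hd * Matrix.diagonal w * (inc n e tl hd)ᵀ
        - κ • (M * (inc n e tl hd)ᵀ)).map Complex.ofReal)).roots, μ ≠ 0 → 0 < μ.re)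
    (p : ℝ → Fin n → ℝ)
    (hp : ∀ t : ℝ, HasDerivAt p
      (-((inc n e tl hd * Matrix.diagonal w * (inc n e tl hd)ᵀ
          - κ • (M * (inc n e tl hd)ᵀ)) *ᵥ p t)
        + (inc n e tl hd * Matrix.diagonal w * (inc n e tl hd)ᵀ) *ᵥ pstar) t) :
    ∃ c₁ : ℝ, Tendsto
      (fun t : ℝ => p t - (c₁ • (1 : Fin n → ℝ) + pstar
        + t • (κ • ((M * (inc n e tl hd)ᵀ) *ᵥ pstar))))
      atTop (𝓝 0) := by
  set B := inc n e tl hd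
  set A := B * Matrix.diagonal w * Bᵀ - κ • (M * Bᵀ) with hA
  have hone : A *ᵥ (1 : Fin n → ℝ) = 0 := by
    rw [hA, Matrix.sub_mulVec, Matrix.smul_mulVec, ← Matrix.mulVec_mulVec,
      ← Matrix.mulVec_mulVec 1 M, inc_transpose_mulVec_one hloop]
    simp
  have hone0 : (1 : Fin n → ℝ) ≠ 0 := fun h => by simpa using congrFun h ⟨0, by omega⟩
  rw [hdesign]
  obtain ⟨a, ha⟩ := A.exists_tendsto_smul_of_hasDerivAt_neg hsimple hspec hone hone0
    (q := fun t => p t - (pstar + t • (κ • (c • (1 : Fin n → ℝ))))) (fun t => by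
      refine ((hp t).sub (((hasDerivAt_id t).smul_const
        (κ • (c • (1 : Fin n → ℝ)))).const_add pstar)).congr_deriv ?_
      have hstar : A *ᵥ pstar = (B * Matrix.diagonal w * Bᵀ) *ᵥ pstar
          - κ • (c • (1 : Fin n → ℝ)) := by
        rw [hA, Matrix.sub_mulVec, Matrix.smul_mulVec, hdesign]
      rw [Matrix.mulVec_sub, Matrix.mulVec_add, hstar]
      simp only [Matrix.mulVec_smul, hone]
      module)
  refine ⟨a, ?_⟩
  have h := ha.sub_const (a • (1 : Fin n → ℝ))
  rw [sub_self] at h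
  refine h.congr fun t => ?_
  module
end

section
/- Suppose all agents share the same scale factor a* > 0 and misalignment R* ∈ SO(m), i.e., D_x = a*(I_n ⊗ R*). Then the condition D_x L̄ p̃* - L̄ p* = -(1_n ⊗ ṽ*) (with L̄ = L ⊗ I_m, L a connected-graph Laplacian) is satisfiable if and only if ṽ* = 0, and the solutions are exactly p̃* = (1/a*)(I_n ⊗ R*^T) p* + 1_n ⊗ b for arbitrary b ∈ R^m. -/
open Matrix Kronecker

lemma inc_transpose_mulVec {n e : ℕ} {tl hd : Fin e → Fin n} (hloop : ∀ k, tl k ≠ hd k)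
    (x : Fin n → ℝ) (k : Fin e) : ((inc n e tl hd)ᵀ *ᵥ x) k = x (tl k) - x (hd k) := by
  have h : ∀ i, (inc n e tl hd) i k * x i
      = (if i = tl k then x i else 0) - (if i = hd k then x i else 0) := by
    intro i
    have := (hloop k).symm
    simp only [inc, Matrix.of_apply]
    split_ifs <;> simp_all
  simp only [Matrix.mulVec, dotProduct, Matrix.transpose_apply, h, Finset.sum_sub_distrib]
  simp

lemma eq_of_laplacian_mulVec_eq_zero {n e : ℕ} {tl hd : Fin e → Fin n}
    (hloop : ∀ k, tl k ≠ hd k) (hconn : Conn n e tl hd) {w : Fin e → ℝ} (hw : ∀ k, 0 < w k)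
    {x : Fin n → ℝ}
    (hx : (inc n e tl hd * Matrix.diagonal w * (inc n e tl hd)ᵀ) *ᵥ x = 0) (i j : Fin n) :
    x i = x j := by
  have hq : ∑ k, w k * (x (tl k) - x (hd k)) ^ 2 = 0 := by
    have h := congrArg (fun y => x ⬝ᵥ y) hx
    simp only [← Matrix.mulVec_mulVec, Matrix.dotProduct_mulVec x (inc n e tl hd),
      ← Matrix.mulVec_transpose (inc n e tl hd), dotProduct_zero] at h
    rw [← h, dotProduct]
    refine Finset.sum_congr rfl fun k _ => ?_
    rw [Matrix.mulVec_diagonal, inc_transpose_mulVec hloop]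
    ring
  have hedge : ∀ k, x (tl k) = x (hd k) := by
    intro k
    have h := (Finset.sum_eq_zero_iff_of_nonneg
      (fun k _ => mul_nonneg (hw k).le (sq_nonneg _))).1 hq k (Finset.mem_univ k)
    have h' := (mul_eq_zero.1 h).resolve_left (hw k).ne'
    exact sub_eq_zero.1 (pow_eq_zero_iff two_ne_zero |>.1 h')
  induction hconn i j with
  | refl => rfl
  | tail _ h ih =>
    obtain ⟨k, ⟨rfl, rfl⟩ | ⟨rfl, rfl⟩⟩ := h
    · exact ih.trans (hedge k)
    · exact ih.trans (hedge k).symm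

lemma laplacian_mulVec_const {n e : ℕ} {tl hd : Fin e → Fin n} (hloop : ∀ k, tl k ≠ hd k)
    (w : Fin e → ℝ) (c : ℝ) :
    (inc n e tl hd * Matrix.diagonal w * (inc n e tl hd)ᵀ) *ᵥ (fun _ => c) = 0 := by
  have h : (inc n e tl hd)ᵀ *ᵥ (fun _ => c) = 0 := by
    ext k
    simp [inc_transpose_mulVec hloop]
  rw [← Matrix.mulVec_mulVec, h, Matrix.mulVec_zero]

lemma sum_laplacian_mulVec {n e : ℕ} {tl hd : Fin e → Fin n} (hloop : ∀ k, tl k ≠ hd k)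
    (w : Fin e → ℝ) (x : Fin n → ℝ) :
    ∑ i, ((inc n e tl hd * Matrix.diagonal w * (inc n e tl hd)ᵀ) *ᵥ x) i = 0 := by
  have h : (inc n e tl hd)ᵀ *ᵥ (1 : Fin n → ℝ) = 0 := by
    ext k
    simp [inc_transpose_mulVec hloop]
  rw [← one_dotProduct, ← Matrix.mulVec_mulVec, ← Matrix.mulVec_mulVec,
    Matrix.dotProduct_mulVec, ← Matrix.mulVec_transpose, h, zero_dotProduct]

lemma kronecker_one_mulVec_apply {n m : ℕ} (L : Matrix (Fin n) (Fin n) ℝ)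
    (x : Fin n × Fin m → ℝ) (i : Fin n) (l : Fin m) :
    ((L ⊗ₖ (1 : Matrix (Fin m) (Fin m) ℝ)) *ᵥ x) (i, l) = (L *ᵥ fun j => x (j, l)) i := by
  simp [Matrix.mulVec, dotProduct, Fintype.sum_prod_type, Matrix.one_apply]

lemma one_kronecker_mulVec_snd {n m : ℕ} (R : Matrix (Fin m) (Fin m) ℝ) (c : Fin m → ℝ) :
    ((1 : Matrix (Fin n) (Fin n) ℝ) ⊗ₖ R) *ᵥ (fun il : Fin n × Fin m => c il.2)
      = fun il => (R *ᵥ c) il.2 := by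
  ext ⟨i, l⟩
  simp [Matrix.mulVec, dotProduct, Fintype.sum_prod_type, Matrix.one_apply]

lemma laplacian_kronecker_one_mulVec_eq_iff {n e m : ℕ} (hn : 0 < n) {tl hd : Fin e → Fin n}
    (hloop : ∀ k, tl k ≠ hd k) (hconn : Conn n e tl hd) {w : Fin e → ℝ} (hw : ∀ k, 0 < w k)
    (v : Fin m → ℝ) (q : Fin n × Fin m → ℝ) :
    ((inc n e tl hd * Matrix.diagonal w * (inc n e tl hd)ᵀ) ⊗ₖ
        (1 : Matrix (Fin m) (Fin m) ℝ)) *ᵥ q = -(fun il : Fin n × Fin m => v il.2)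
      ↔ v = 0 ∧ ∃ c : Fin m → ℝ, q = fun il => c il.2 := by
  constructor
  · intro h
    have hpt : ∀ l i, ((inc n e tl hd * Matrix.diagonal w * (inc n e tl hd)ᵀ) *ᵥ
        fun j => q (j, l)) i = -v l := by
      intro l i
      rw [← kronecker_one_mulVec_apply, h]
      rfl
    have hv : v = 0 := by
      ext l
      have hs := sum_laplacian_mulVec hloop w fun j => q (j, l)
      simpa [hpt, hn.ne'] using hs
    subst hv
    refine ⟨rfl, fun l => q (⟨0, hn⟩, l), ?_⟩
    ext ⟨i, l⟩
    refine eq_of_laplacian_mulVec_eq_zero (x := fun j => q (j, l)) hloop hconn hw ?_ i ⟨0, hn⟩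
    ext j
    simp [hpt]
  · rintro ⟨rfl, c, rfl⟩
    ext ⟨i, l⟩
    rw [kronecker_one_mulVec_apply]
    change (_ *ᵥ fun _ => c l) i = _
    rw [laplacian_mulVec_const hloop]
    simp

/-- With identical sensing `D_x = a*(Iₙ ⊗ R*)`, the condition
`D_x L̄ p̃* - L̄ p* = -(1ₙ ⊗ ṽ*)` holds iff `ṽ* = 0` and
`p̃* = (1/a*)(Iₙ ⊗ R*ᵀ) p* + 1ₙ ⊗ b` for some `b`. -/
theorem stmt11 (n e m : ℕ) (hn : 2 ≤ n) (tl hd : Fin e → Fin n)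
    (hloop : ∀ k, tl k ≠ hd k) (hconn : Conn n e tl hd)
    (w : Fin e → ℝ) (hw : ∀ k, 0 < w k)
    (astar : ℝ) (ha : 0 < astar)
    (R : Matrix (Fin m) (Fin m) ℝ) (hR : Rᵀ * R = 1) (hdet : R.det = 1)
    (pstar : Fin n × Fin m → ℝ) :
    ∀ (vt : Fin m → ℝ) (pt : Fin n × Fin m → ℝ),
      ((astar • ((1 : Matrix (Fin n) (Fin n) ℝ) ⊗ₖ R)) *
          ((inc n e tl hd * Matrix.diagonal w * (inc n e tl hd)ᵀ) ⊗ₖ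
            (1 : Matrix (Fin m) (Fin m) ℝ))) *ᵥ pt -
        ((inc n e tl hd * Matrix.diagonal w * (inc n e tl hd)ᵀ) ⊗ₖ
            (1 : Matrix (Fin m) (Fin m) ℝ)) *ᵥ pstar
        = -(fun il : Fin n × Fin m => vt il.2)
      ↔ (vt = 0 ∧ ∃ b : Fin m → ℝ,
          pt = (1 / astar) • (((1 : Matrix (Fin n) (Fin n) ℝ) ⊗ₖ Rᵀ) *ᵥ pstar)
            + fun il : Fin n × Fin m => b il.2) := by
  intro vt pt
  have hR' : R * Rᵀ = 1 := mul_eq_one_comm.1 hR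
  set D := (1 : Matrix (Fin n) (Fin n) ℝ) ⊗ₖ R with hD
  set D' := (1 : Matrix (Fin n) (Fin n) ℝ) ⊗ₖ Rᵀ with hD'
  have hDD' : D * D' = 1 := by
    rw [hD, hD', ← Matrix.mul_kronecker_mul, hR', one_mul, Matrix.one_kronecker_one]
  have hD'D : D' * D = 1 := mul_eq_one_comm.1 hDD'
  have hcomm : ∀ L : Matrix (Fin n) (Fin n) ℝ,
      (astar • D) * (L ⊗ₖ (1 : Matrix (Fin m) (Fin m) ℝ))
        = (L ⊗ₖ (1 : Matrix (Fin m) (Fin m) ℝ)) * (astar • D) := by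
    intro L
    rw [hD, Matrix.smul_mul, Matrix.mul_smul, ← Matrix.mul_kronecker_mul,
      ← Matrix.mul_kronecker_mul, one_mul, mul_one, one_mul, mul_one]
  rw [hcomm, ← Matrix.mulVec_mulVec, ← Matrix.mulVec_sub,
    laplacian_kronecker_one_mulVec_eq_iff (by omega) hloop hconn hw]
  refine and_congr_right fun _ => ⟨?_, ?_⟩
  · rintro ⟨c, hc⟩
    refine ⟨(1 / astar) • (Rᵀ *ᵥ c), ?_⟩
    have h := congrArg (fun y => (1 / astar) • (D' *ᵥ y)) (sub_eq_iff_eq_add'.1 hc)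
    simp only [Matrix.smul_mulVec, Matrix.mulVec_smul, Matrix.mulVec_mulVec, hD'D,
      Matrix.one_mulVec, smul_smul, one_div_mul_cancel ha.ne', one_smul, Matrix.mulVec_add,
      smul_add] at h
    rw [h, hD', one_kronecker_mulVec_snd]
    rfl
  · rintro ⟨b, rfl⟩
    refine ⟨astar • (R *ᵥ b), ?_⟩
    rw [Matrix.mulVec_add, Matrix.smul_mulVec, Matrix.mulVec_smul, Matrix.mulVec_mulVec, hDD',
      Matrix.one_mulVec, smul_smul, mul_one_div_cancel ha.ne', one_smul, add_sub_cancel_left,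
      Matrix.smul_mulVec, hD, one_kronecker_mulVec_snd]
    rfl
end

section
/- Under imperfect but identical sensing D_x = a*(I_n ⊗ R*) with a* > 0 and R* ∈ SO(m) close enough to the identity that all nonzero eigenvalues of D_x L̄ have positive real part, every solution of ṗ = -D_x L̄ p + L̄ p* converges to a static distorted shape: p(t) → (1/a*)(I_n ⊗ R*^T) p* + 1_n ⊗ b for some b ∈ R^m, and ṗ(t) → 0. -/
open Matrix Kronecker Filter Topology

lemma sum_inc_mul {n e : ℕ} {tl hd : Fin e → Fin n} (hloop : ∀ k, tl k ≠ hd k)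
    (f : Fin n → ℝ) (k : Fin e) :
    ∑ i, inc n e tl hd i k * f i = f (tl k) - f (hd k) := by
  have h : ∀ i, inc n e tl hd i k * f i =
      (if i = tl k then f i else 0) - (if i = hd k then f i else 0) := by
    intro i
    by_cases h1 : i = tl k
    · have h2 : i ≠ hd k := fun h => hloop k (h1.symm.trans h)
      have h3 : tl k ≠ hd k := hloop k
      simp [inc, h1, h3]
    · by_cases h2 : i = hd k <;> simp [inc, h1, h2]
      have h3 := (hloop k).symm
      simp [h3]
  simp [h, Finset.sum_sub_distrib]

/-- A Poincaré inequality for connected weighted graphs. -/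
lemma exists_sum_sq_le_edge_energy {n e : ℕ} {tl hd : Fin e → Fin n}
    (hconn : Conn n e tl hd) {w : Fin e → ℝ} (hw : ∀ k, 0 < w k) :
    ∃ C : ℝ, 0 < C ∧ ∀ f : Fin n → ℝ, ∑ i, f i = 0 →
      ∑ i, f i ^ 2 ≤ C * ∑ k, w k * (f (tl k) - f (hd k)) ^ 2 := by
  have hE : ∀ f : Fin n → ℝ, 0 ≤ ∑ k, w k * (f (tl k) - f (hd k)) ^ 2 := fun f =>
    Finset.sum_nonneg fun k _ => mul_nonneg (hw k).le (sq_nonneg _)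
  have hpair : ∀ i j : Fin n, ∃ C : ℝ, 0 ≤ C ∧ ∀ f : Fin n → ℝ,
      (f i - f j) ^ 2 ≤ C * ∑ k, w k * (f (tl k) - f (hd k)) ^ 2 := by
    intro i j
    induction hconn i j with
    | refl => exact ⟨0, le_rfl, fun f => by simp⟩
    | @tail b c _ hbc ih =>
      obtain ⟨C, hC, h⟩ := ih
      obtain ⟨k, hk⟩ := hbc
      refine ⟨2 * C + 2 / w k, by have := hw k; positivity, fun f => ?_⟩
      have hedge : (f b - f c) ^ 2 ≤ (1 / w k) * ∑ k, w k * (f (tl k) - f (hd k)) ^ 2 := by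
        rw [one_div, ← div_eq_inv_mul, le_div_iff₀' (hw k)]
        have h1 := Finset.single_le_sum
          (f := fun k => w k * (f (tl k) - f (hd k)) ^ 2)
          (fun k _ => mul_nonneg (hw k).le (sq_nonneg _)) (Finset.mem_univ k)
        refine le_trans (le_of_eq ?_) h1
        rcases hk with ⟨rfl, rfl⟩ | ⟨rfl, rfl⟩
        · rfl
        · ring
      have h2 := h f
      have h3 : (2 * C + 2 / w k) * ∑ k, w k * (f (tl k) - f (hd k)) ^ 2 =
          2 * (C * ∑ k, w k * (f (tl k) - f (hd k)) ^ 2) +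
          2 * (1 / w k * ∑ k, w k * (f (tl k) - f (hd k)) ^ 2) := by ring
      rw [h3]
      nlinarith [sq_nonneg ((f i - f b) - (f b - f c))]
  choose C hC h using hpair
  refine ⟨(∑ i, ∑ j, C i j) + 1,
    by have := Finset.sum_nonneg fun i (_ : i ∈ Finset.univ) =>
        Finset.sum_nonneg fun j (_ : j ∈ Finset.univ) => hC i j
       linarith, fun f hf => ?_⟩
  have hsum : ∑ i, ∑ j, (f i - f j) ^ 2 = 2 * n * ∑ i, f i ^ 2 := by
    have : ∀ i j, (f i - f j) ^ 2 = f i ^ 2 - 2 * f i * f j + f j ^ 2 := fun i j => by ring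
    simp only [this, Finset.sum_add_distrib, Finset.sum_sub_distrib, ← Finset.mul_sum, hf]
    simp [← Finset.mul_sum]
    ring
  have hle : ∑ i, ∑ j, (f i - f j) ^ 2 ≤
      (∑ i, ∑ j, C i j) * ∑ k, w k * (f (tl k) - f (hd k)) ^ 2 := by
    simp only [Finset.sum_mul (s := Finset.univ) (ι := Fin n)]
    exact Finset.sum_le_sum fun i _ => Finset.sum_le_sum fun j _ => h i j f
  have hnn : 0 ≤ ∑ i, f i ^ 2 := Finset.sum_nonneg fun i _ => sq_nonneg _
  rcases Nat.eq_zero_or_pos n with rfl | hn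
  · simpa using hE f
  have hn1 : (1 : ℝ) ≤ n := by exact_mod_cast hn
  nlinarith [hE f, mul_nonneg (sub_nonneg.2 hn1) hnn]

/-- If `s` is an eigenvalue of the symmetric part of an orthogonal matrix `R`, then `s` is the
real part of an eigenvalue of `R`. -/
lemma exists_eigenvector_of_symm_part {m : ℕ} {R : Matrix (Fin m) (Fin m) ℝ} (hR : Rᵀ * R = 1)
    {s : ℝ} {v : Fin m → ℝ} (hv : v ≠ 0) (hs : R *ᵥ v + Rᵀ *ᵥ v = (2 * s) • v)
    (hs1 : s ^ 2 ≤ 1) :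
    ∃ ρ : ℂ, ρ.re = s ∧ ∃ x : Fin m → ℂ, x ≠ 0 ∧ R.map Complex.ofReal *ᵥ x = ρ • x := by
  set c := Real.sqrt (1 - s ^ 2) with hc
  have hc2 : c ^ 2 = 1 - s ^ 2 := Real.sq_sqrt (by linarith)
  have hRt : R * Rᵀ = 1 := mul_eq_one_comm.1 hR
  have hRR : R *ᵥ (R *ᵥ v) = (2 * s) • (R *ᵥ v) - v := by
    have := congrArg (R *ᵥ ·) hs
    simp only [mulVec_add, mulVec_smul] at this
    rw [mulVec_mulVec v R Rᵀ, hRt, one_mulVec] at this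
    exact eq_sub_of_add_eq this
  have hmap : ∀ y : Fin m → ℝ,
      R.map Complex.ofReal *ᵥ (fun i => (y i : ℂ)) = fun i => ((R *ᵥ y) i : ℂ) := by
    intro y
    ext i
    simp [mulVec, dotProduct]
  set vc : Fin m → ℂ := fun i => (v i : ℂ) with hvc
  have hvc0 : vc ≠ 0 := by
    intro h
    apply hv
    ext i
    simpa [hvc] using congrFun h i
  set uc : Fin m → ℂ := fun i => ((R *ᵥ v) i : ℂ) with huc
  have h1 : R.map Complex.ofReal *ᵥ vc = uc := hmap v
  have h2 : R.map Complex.ofReal *ᵥ uc = (2 * s : ℂ) • uc - vc := by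
    rw [huc, hmap, hRR]
    ext i
    simp [hvc]
  have hcc : (c : ℂ) ^ 2 = 1 - (s : ℂ) ^ 2 := by exact_mod_cast hc2
  by_cases hx : uc = (s - c * Complex.I : ℂ) • vc
  · exact ⟨s - c * Complex.I, by simp, vc, hvc0, h1.trans hx⟩
  · refine ⟨s + c * Complex.I, by simp, uc - (s - c * Complex.I : ℂ) • vc,
      sub_ne_zero.2 hx, ?_⟩
    rw [mulVec_sub, mulVec_smul, h1, h2]
    ext i
    simp only [Pi.sub_apply, Pi.smul_apply, smul_eq_mul]
    have hI : Complex.I ^ 2 = -1 := Complex.I_sq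
    linear_combination (-(c : ℂ) ^ 2 * vc i) * hI + vc i * hcc

lemma mem_roots_charpoly_of_mulVec_eq_smul {ι : Type*} [Fintype ι] [DecidableEq ι]
    {A : Matrix ι ι ℂ} {μ : ℂ} {z : ι → ℂ} (hz : z ≠ 0) (h : A *ᵥ z = μ • z) :
    μ ∈ A.charpoly.roots := by
  rw [Polynomial.mem_roots (charpoly_monic A).ne_zero, Polynomial.IsRoot, eval_charpoly,
    ← exists_mulVec_eq_zero_iff]
  refine ⟨z, hz, ?_⟩
  rw [sub_mulVec, h]
  ext i
  simp [scalar_apply]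

lemma map_smul_kronecker_mulVec {n m : ℕ} (a : ℝ) (L : Matrix (Fin n) (Fin n) ℝ)
    (R : Matrix (Fin m) (Fin m) ℝ) {l : ℝ} {ρ : ℂ} {u : Fin n → ℝ} {x : Fin m → ℂ}
    (hu : L *ᵥ u = l • u) (hx : R.map Complex.ofReal *ᵥ x = ρ • x) :
    (a • L ⊗ₖ R).map Complex.ofReal *ᵥ (fun i => (u i.1 : ℂ) * x i.2) =
      (a * l * ρ : ℂ) • fun i => (u i.1 : ℂ) * x i.2 := by
  ext ⟨i, j⟩
  have h1 : ∑ k, (L i k : ℂ) * u k = l * u i := by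
    exact_mod_cast congrFun hu i
  have h2 : ∑ k, (R j k : ℂ) * x k = ρ * x j := congrFun hx j
  simp only [mulVec, dotProduct, map_apply, Matrix.smul_apply, kroneckerMap_apply, Fintype.sum_prod_type,
    Pi.smul_apply, smul_eq_mul, Complex.ofReal_mul]
  calc _ = a * ((∑ k, (L i k : ℂ) * u k) * ∑ k, (R j k : ℂ) * x k) := by
        rw [Finset.sum_mul_sum]
        simp only [Finset.mul_sum]
        refine Finset.sum_congr rfl fun k _ => Finset.sum_congr rfl fun k' _ => ?_
        ring
    _ = _ := by rw [h1, h2]; ring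

lemma exists_pos_eigenvalue_of_trace_pos {n : ℕ} {L : Matrix (Fin n) (Fin n) ℝ}
    (hL : L.IsHermitian) (htr : 0 < L.trace) :
    ∃ l : ℝ, 0 < l ∧ ∃ u : Fin n → ℝ, u ≠ 0 ∧ L *ᵥ u = l • u := by
  rw [hL.trace_eq_sum_eigenvalues] at htr
  obtain ⟨i, hi⟩ : ∃ i, 0 < hL.eigenvalues i := by
    by_contra! h
    exact htr.not_ge (by simpa using Finset.sum_nonpos fun i _ => h i)
  refine ⟨hL.eigenvalues i, hi, hL.eigenvectorBasis i, ?_,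
    hL.mulVec_eigenvectorBasis i⟩
  intro h
  exact hL.eigenvectorBasis.orthonormal.ne_zero i (by ext j; exact congrFun h j)

/-- The quadratic form of a symmetric matrix with positive eigenvalues is coercive. -/
lemma exists_le_dotProduct_mulVec_of_isHermitian {m : ℕ} {S : Matrix (Fin m) (Fin m) ℝ}
    (hS : S.IsHermitian) (hpos : ∀ (s : ℝ) (v : Fin m → ℝ), v ≠ 0 → S *ᵥ v = s • v → 0 < s) :
    ∃ c : ℝ, 0 < c ∧ ∀ v : Fin m → ℝ, c * (v ⬝ᵥ v) ≤ v ⬝ᵥ (S *ᵥ v) := by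
  set b : Fin m → Fin m → ℝ := fun i => ⇑(hS.eigenvectorBasis i) with hb
  have hparseval : ∀ v w : Fin m → ℝ, v ⬝ᵥ w = ∑ i, (v ⬝ᵥ b i) * (b i ⬝ᵥ w) := by
    intro v w
    have h := hS.eigenvectorBasis.sum_inner_mul_inner (WithLp.toLp 2 v) (WithLp.toLp 2 w)
    simp only [EuclideanSpace.inner_eq_star_dotProduct, star_trivial] at h
    rw [dotProduct_comm v w, ← h]
    refine Finset.sum_congr rfl fun i _ => ?_
    rw [dotProduct_comm v, dotProduct_comm _ w]
  have hev : ∀ i, S *ᵥ b i = hS.eigenvalues i • b i := fun i => hS.mulVec_eigenvectorBasis i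
  have hlpos : ∀ i, 0 < hS.eigenvalues i := by
    refine fun i => hpos _ (b i) (fun h => ?_) (hev i)
    exact hS.eigenvectorBasis.orthonormal.ne_zero i (by ext j; exact congrFun h j)
  obtain ⟨c, hc, hcl⟩ : ∃ c : ℝ, 0 < c ∧ ∀ i, c ≤ hS.eigenvalues i := by
    rcases isEmpty_or_nonempty (Fin m) with h | h
    · exact ⟨1, one_pos, fun i => h.elim i⟩
    · obtain ⟨i, hi⟩ := Finite.exists_min hS.eigenvalues
      exact ⟨_, hlpos i, hi⟩
  refine ⟨c, hc, fun v => ?_⟩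
  have hbS : ∀ i, b i ⬝ᵥ (S *ᵥ v) = hS.eigenvalues i * (b i ⬝ᵥ v) := by
    intro i
    rw [dotProduct_mulVec, ← mulVec_transpose, ← conjTranspose_eq_transpose_of_trivial, hS.eq,
      hev, smul_dotProduct, smul_eq_mul]
  rw [hparseval v (S *ᵥ v), hparseval v v, Finset.mul_sum]
  refine Finset.sum_le_sum fun i _ => ?_
  rw [hbS, dotProduct_comm v (b i)]
  nlinarith [hcl i, mul_le_mul_of_nonneg_right (hcl i) (mul_self_nonneg (b i ⬝ᵥ v))]

/-- An orthogonal matrix whose eigenvalues have positive real part has a coercive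
quadratic form. -/
lemma exists_le_dotProduct_mulVec {m : ℕ} {R : Matrix (Fin m) (Fin m) ℝ} (hR : Rᵀ * R = 1)
    (hpos : ∀ (ρ : ℂ) (x : Fin m → ℂ), x ≠ 0 → R.map Complex.ofReal *ᵥ x = ρ • x → 0 < ρ.re) :
    ∃ c : ℝ, 0 < c ∧ ∀ v : Fin m → ℝ, c * (v ⬝ᵥ v) ≤ v ⬝ᵥ (R *ᵥ v) := by
  have htr : ∀ v : Fin m → ℝ, v ⬝ᵥ (Rᵀ *ᵥ v) = v ⬝ᵥ (R *ᵥ v) := fun v => by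
    rw [mulVec_transpose, dotProduct_comm, ← dotProduct_mulVec]
  have hS : (R + Rᵀ).IsHermitian := by
    rw [IsHermitian, conjTranspose_eq_transpose_of_trivial, transpose_add, transpose_transpose,
      add_comm]
  obtain ⟨c, hc, h⟩ := exists_le_dotProduct_mulVec_of_isHermitian hS (by
    intro s v hv hs
    by_contra hs0
    rw [not_lt] at hs0
    have hvv : 0 < v ⬝ᵥ v := by
      have h := dotProduct_star_self_pos_iff.2 hv
      simpa using h
    have hnorm : (R *ᵥ v) ⬝ᵥ (R *ᵥ v) = v ⬝ᵥ v := by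
      rw [dotProduct_mulVec, ← mulVec_transpose, mulVec_mulVec, hR, one_mulVec]
    have hq : 2 * (v ⬝ᵥ (R *ᵥ v)) = s * (v ⬝ᵥ v) := by
      have := congrArg (v ⬝ᵥ ·) hs
      simp only [add_mulVec, dotProduct_add, htr, dotProduct_smul, smul_eq_mul] at this
      linarith
    have hlow : 0 ≤ (R *ᵥ v + v) ⬝ᵥ (R *ᵥ v + v) := by
      simpa using dotProduct_star_self_nonneg (R *ᵥ v + v)
    simp only [dotProduct_add, add_dotProduct, hnorm, dotProduct_comm (R *ᵥ v) v] at hlow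
    have hs2 : -2 ≤ s := by
      by_contra hlt
      nlinarith
    obtain ⟨ρ, hρ, x, hx, hxe⟩ := exists_eigenvector_of_symm_part (s := s / 2) hR hv
      (by rw [← add_mulVec, hs]; congr 1; ring) (by nlinarith)
    have := hpos ρ x hx hxe
    linarith)
  refine ⟨c / 2, by positivity, fun v => ?_⟩
  have := h v
  rw [add_mulVec, dotProduct_add, htr] at this
  linarith

lemma kronecker_energy {n e m : ℕ} {tl hd : Fin e → Fin n} (hloop : ∀ k, tl k ≠ hd k)
    (w : Fin e → ℝ) (R : Matrix (Fin m) (Fin m) ℝ) (r : Fin n × Fin m → ℝ) :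
    r ⬝ᵥ (((inc n e tl hd * diagonal w * (inc n e tl hd)ᵀ) ⊗ₖ R) *ᵥ r) =
      ∑ k, w k * ((fun j => r (tl k, j) - r (hd k, j)) ⬝ᵥ
        (R *ᵥ fun j => r (tl k, j) - r (hd k, j))) := by
  set B := inc n e tl hd with hB
  have hfac : (B * diagonal w * Bᵀ) ⊗ₖ R =
      (B ⊗ₖ (1 : Matrix (Fin m) (Fin m) ℝ)) * (diagonal w ⊗ₖ R) *
        (B ⊗ₖ (1 : Matrix (Fin m) (Fin m) ℝ))ᵀ := by
    rw [← kroneckerMap_transpose, transpose_one, ← mul_kronecker_mul, ← mul_kronecker_mul, one_mul,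
      mul_one]
  have hy : (B ⊗ₖ (1 : Matrix (Fin m) (Fin m) ℝ))ᵀ *ᵥ r =
      fun kj => r (tl kj.1, kj.2) - r (hd kj.1, kj.2) := by
    ext ⟨k, j⟩
    rw [← sum_inc_mul hloop (fun i => r (i, j)) k]
    simp [mulVec, dotProduct, Fintype.sum_prod_type, one_apply, hB]
  rw [hfac, ← mulVec_mulVec, ← mulVec_mulVec, dotProduct_mulVec, ← mulVec_transpose, hy]
  simp [mulVec, dotProduct, Fintype.sum_prod_type, diagonal_apply, Finset.mul_sum]
  exact Finset.sum_congr rfl fun k _ => Finset.sum_congr rfl fun j _ =>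
    Finset.sum_congr rfl fun j' _ => by ring

/-- Solutions of `r' = -M r` decay to zero when the quadratic form of `M` is coercive along
them. -/
lemma tendsto_zero_of_coercive {ι : Type*} [Fintype ι] {M : Matrix ι ι ℝ} {κ : ℝ} (hκ : 0 < κ)
    {r : ℝ → ι → ℝ} (hr : ∀ t, HasDerivAt r (-(M *ᵥ r t)) t)
    (hco : ∀ t, κ * (r t ⬝ᵥ r t) ≤ r t ⬝ᵥ (M *ᵥ r t)) :
    Tendsto r atTop (𝓝 0) := by
  have hd : ∀ t, HasDerivAt (fun t => Real.exp (2 * κ * t) * (r t ⬝ᵥ r t))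
      (Real.exp (2 * κ * t) * (2 * (κ * (r t ⬝ᵥ r t) - r t ⬝ᵥ (M *ᵥ r t)))) t := by
    intro t
    have h1 : HasDerivAt (fun t => r t ⬝ᵥ r t) (∑ i, (-(M *ᵥ r t) i * r t i
        + r t i * -(M *ᵥ r t) i)) t :=
      HasDerivAt.fun_sum fun i _ =>
        (hasDerivAt_pi.1 (hr t) i).fun_mul (hasDerivAt_pi.1 (hr t) i)
    have h2 : HasDerivAt (fun t : ℝ => Real.exp (2 * κ * t))
        (Real.exp (2 * κ * t) * (2 * κ * 1)) t :=
      ((hasDerivAt_id t).const_mul (2 * κ)).exp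
    have h3 : ∑ i, (-(M *ᵥ r t) i * r t i + r t i * -(M *ᵥ r t) i) =
        -2 * (r t ⬝ᵥ (M *ᵥ r t)) := by
      rw [dotProduct, Finset.mul_sum]
      exact Finset.sum_congr rfl fun i _ => by ring
    rw [h3] at h1
    exact (h2.fun_mul h1).congr_deriv (by ring)
  have hanti := antitone_of_hasDerivAt_nonpos hd fun t =>
    mul_nonpos_of_nonneg_of_nonpos (Real.exp_pos _).le (by linarith [hco t])
  have hexp : Tendsto (fun t : ℝ => (r 0 ⬝ᵥ r 0) * Real.exp (-(2 * κ * t))) atTop (𝓝 0) := by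
    have h : Tendsto (fun t : ℝ => 2 * κ * t) atTop atTop :=
      tendsto_id.const_mul_atTop (by positivity)
    simpa using (Real.tendsto_exp_neg_atTop_nhds_zero.comp h).const_mul (r 0 ⬝ᵥ r 0)
  rw [tendsto_pi_nhds]
  intro i
  have hsq : Tendsto (fun t => r t i ^ 2) atTop (𝓝 0) := by
    refine tendsto_of_tendsto_of_tendsto_of_le_of_le' tendsto_const_nhds hexp
      (Eventually.of_forall fun t => sq_nonneg _) ?_
    filter_upwards [eventually_ge_atTop 0] with t ht
    have h1 := hanti ht
    simp only [mul_zero, Real.exp_zero, one_mul] at h1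
    have h2 : r t i ^ 2 ≤ r t ⬝ᵥ r t := by
      rw [sq]
      exact Finset.single_le_sum (f := fun i => r t i * r t i)
        (fun i _ => mul_self_nonneg _) (Finset.mem_univ i)
    rw [Real.exp_neg, ← div_eq_mul_inv, le_div_iff₀' (Real.exp_pos _)]
    exact le_trans (mul_le_mul_of_nonneg_left h2 (Real.exp_pos _).le) h1
  have := hsq.sqrt
  simp only [Real.sqrt_sq_eq_abs, Real.sqrt_zero] at this
  exact (tendsto_zero_iff_abs_tendsto_zero _).2 this

/-- Under identical imperfect sensing `D_x = a*(Iₙ ⊗ R*)` with all nonzero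
eigenvalues of `D_x L̄` of positive real part, every solution of
`ṗ = -D_x L̄ p + L̄ p*` converges to the static distorted shape
`(1/a*)(Iₙ ⊗ R*ᵀ) p* + 1ₙ ⊗ b`, with velocity tending to zero. -/
theorem stmt19 (n e m : ℕ) (hn : 2 ≤ n) (tl hd : Fin e → Fin n)
    (hloop : ∀ k, tl k ≠ hd k) (hconn : Conn n e tl hd)
    (w : Fin e → ℝ) (hw : ∀ k, 0 < w k)
    (astar : ℝ) (ha : 0 < astar)
    (R : Matrix (Fin m) (Fin m) ℝ) (hR : Rᵀ * R = 1) (hdet : R.det = 1)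
    (Dx : Matrix (Fin n × Fin m) (Fin n × Fin m) ℝ)
    (hDx : Dx = astar • ((1 : Matrix (Fin n) (Fin n) ℝ) ⊗ₖ R))
    (Lbar : Matrix (Fin n × Fin m) (Fin n × Fin m) ℝ)
    (hLbar : Lbar = (inc n e tl hd * Matrix.diagonal w * (inc n e tl hd)ᵀ) ⊗ₖ
      (1 : Matrix (Fin m) (Fin m) ℝ))
    (hspec : ∀ μ ∈ (Matrix.charpoly ((Dx * Lbar).map Complex.ofReal)).roots,
      μ ≠ 0 → 0 < μ.re)
    (pstar : Fin n × Fin m → ℝ) (p : ℝ → Fin n × Fin m → ℝ)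
    (hp : ∀ t : ℝ, HasDerivAt p (-((Dx * Lbar) *ᵥ p t) + Lbar *ᵥ pstar) t) :
    ∃ b : Fin m → ℝ,
      Tendsto p atTop (𝓝 ((1 / astar) •
        (((1 : Matrix (Fin n) (Fin n) ℝ) ⊗ₖ Rᵀ) *ᵥ pstar)
          + fun il : Fin n × Fin m => b il.2)) ∧
      Tendsto (fun t : ℝ => -((Dx * Lbar) *ᵥ p t) + Lbar *ᵥ pstar) atTop (𝓝 0) := by
  set B := inc n e tl hd with hB
  set L := B * diagonal w * Bᵀ with hL
  have hRt : R * Rᵀ = 1 := mul_eq_one_comm.1 hR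
  have hM : Dx * Lbar = astar • (L ⊗ₖ R) := by
    rw [hDx, hLbar, smul_mul, ← mul_kronecker_mul, one_mul, mul_one]
  rw [hM] at hspec hp ⊢
  have hcol : ∀ k, ∑ i, B i k = 0 := fun k => by
    simpa using sum_inc_mul hloop (fun _ => 1) k
  have hLcol : ∀ j, ∑ i, L i j = 0 := by
    intro j
    simp only [hL, mul_apply (M := B * diagonal w), mul_diagonal]
    rw [Finset.sum_comm]
    simp [← Finset.sum_mul, hcol]
  have hLrow : ∀ i, ∑ j, L i j = 0 := by
    intro j
    simp only [hL, mul_apply (M := B * diagonal w), mul_diagonal]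
    rw [Finset.sum_comm]
    simp [← Finset.mul_sum, hcol]
  have hLherm : L.IsHermitian := by
    rw [IsHermitian, conjTranspose_eq_transpose_of_trivial, hL, transpose_mul, transpose_mul,
      transpose_transpose, diagonal_transpose, Matrix.mul_assoc]
  have htr : 0 < L.trace := by
    have hedge : Nonempty (Fin e) := by
      by_contra hempty
      have h01 : (⟨0, by omega⟩ : Fin n) ≠ ⟨1, by omega⟩ := by simp
      rcases Relation.ReflTransGen.cases_head (hconn ⟨0, by omega⟩ ⟨1, by omega⟩) with
        h | ⟨_, ⟨k, _⟩, _⟩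
      · exact h01 h
      · exact hempty ⟨k⟩
    obtain ⟨k₀⟩ := hedge
    simp only [trace, diag_apply, hL, mul_apply (M := B * diagonal w), mul_diagonal,
      transpose_apply]
    refine Finset.sum_pos' (fun i _ => Finset.sum_nonneg fun k _ => ?_)
      ⟨tl k₀, Finset.mem_univ _, Finset.sum_pos' (fun k _ => ?_) ⟨k₀, Finset.mem_univ _, ?_⟩⟩
    · nlinarith [mul_nonneg (hw k).le (mul_self_nonneg (B i k))]
    · nlinarith [mul_nonneg (hw k).le (mul_self_nonneg (B (tl k₀) k))]
    · simpa [hB, inc] using hw k₀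
  obtain ⟨l, hl, u, hu, hLu⟩ := exists_pos_eigenvalue_of_trace_pos hLherm htr
  obtain ⟨c, hc, hcR⟩ := exists_le_dotProduct_mulVec hR (by
    intro ρ x hx hRx
    have hρ : ρ ≠ 0 := by
      rintro rfl
      apply hx
      have hcx : Rᵀ.map Complex.ofReal * R.map Complex.ofReal = 1 := by
        have h := Matrix.map_mul (L := Rᵀ) (M := R) (f := Complex.ofRealHom)
        rw [hR, Matrix.map_one _ (map_zero _) (map_one _)] at h
        exact h.symm
      rw [← one_mulVec x, ← hcx, ← mulVec_mulVec, hRx, zero_smul, mulVec_zero]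
    have hz : (fun i : Fin n × Fin m => (u i.1 : ℂ) * x i.2) ≠ 0 := by
      obtain ⟨i, hi⟩ := Function.ne_iff.1 hu
      obtain ⟨j, hj⟩ := Function.ne_iff.1 hx
      intro h
      have := congrFun h (i, j)
      simp_all
    have h := hspec _ (mem_roots_charpoly_of_mulVec_eq_smul hz
      (map_smul_kronecker_mulVec astar L R hLu hRx))
      (mul_ne_zero (by exact_mod_cast (mul_pos ha hl).ne') hρ)
    rw [← Complex.ofReal_mul, Complex.re_ofReal_mul] at h
    exact pos_of_mul_pos_right h (mul_pos ha hl).le)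
  obtain ⟨C, hC, hpoinc⟩ := exists_sum_sq_le_edge_energy hconn hw
  have hcoer : ∀ r : Fin n × Fin m → ℝ, (∀ j, ∑ i, r (i, j) = 0) →
      astar * c / C * (r ⬝ᵥ r) ≤ r ⬝ᵥ ((astar • (L ⊗ₖ R)) *ᵥ r) := by
    intro r hr
    have h1 : r ⬝ᵥ r ≤ C * ∑ k, w k * ((fun j => r (tl k, j) - r (hd k, j)) ⬝ᵥ
        (fun j => r (tl k, j) - r (hd k, j))) := by
      calc r ⬝ᵥ r = ∑ j, ∑ i, r (i, j) ^ 2 := by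
            simp only [dotProduct, Fintype.sum_prod_type, ← sq]
            exact Finset.sum_comm
        _ ≤ ∑ j, C * ∑ k, w k * (r (tl k, j) - r (hd k, j)) ^ 2 :=
            Finset.sum_le_sum fun j _ => hpoinc (fun i => r (i, j)) (hr j)
        _ = _ := by
            rw [← Finset.mul_sum, Finset.sum_comm]
            simp only [dotProduct, ← sq, Finset.mul_sum]
    have h2 : c * ∑ k, w k * ((fun j => r (tl k, j) - r (hd k, j)) ⬝ᵥ
        (fun j => r (tl k, j) - r (hd k, j))) ≤ r ⬝ᵥ ((L ⊗ₖ R) *ᵥ r) := by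
      rw [kronecker_energy hloop w R r, Finset.mul_sum]
      refine Finset.sum_le_sum fun k _ => ?_
      rw [mul_left_comm]
      exact mul_le_mul_of_nonneg_left (hcR _) (hw k).le
    rw [smul_mulVec, dotProduct_smul, smul_eq_mul, mul_div_assoc, mul_assoc]
    refine mul_le_mul_of_nonneg_left (le_trans ?_ h2) ha.le
    rw [div_mul_eq_mul_div, div_le_iff₀ hC]
    nlinarith [mul_le_mul_of_nonneg_left h1 hc.le]
  set peq : Fin n × Fin m → ℝ :=
    (1 / astar) • (((1 : Matrix (Fin n) (Fin n) ℝ) ⊗ₖ Rᵀ) *ᵥ pstar) with hpeq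
  have hMpeq : (astar • (L ⊗ₖ R)) *ᵥ peq = Lbar *ᵥ pstar := by
    rw [hpeq, mulVec_smul, smul_mulVec, smul_smul, one_div_mul_cancel ha.ne', one_smul,
      mulVec_mulVec, ← mul_kronecker_mul, hRt, mul_one, hLbar]
  have hMconst : ∀ b : Fin m → ℝ,
      (astar • (L ⊗ₖ R)) *ᵥ (fun il : Fin n × Fin m => b il.2) = 0 := by
    intro b
    rw [smul_mulVec]
    have : (L ⊗ₖ R) *ᵥ (fun il : Fin n × Fin m => b il.2) = 0 := by
      ext ⟨i, j⟩
      simp only [mulVec, dotProduct, kroneckerMap_apply, Fintype.sum_prod_type, mul_assoc,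
        ← Finset.mul_sum, ← Finset.sum_mul, hLrow, zero_mul, Pi.zero_apply]
    rw [this, smul_zero]
  have hMsum : ∀ (r : Fin n × Fin m → ℝ) (j : Fin m),
      ∑ i, ((astar • (L ⊗ₖ R)) *ᵥ r) (i, j) = 0 := by
    intro r j
    have : ∑ i, ((L ⊗ₖ R) *ᵥ r) (i, j) = 0 := by
      simp only [mulVec, dotProduct, kroneckerMap_apply]
      rw [Finset.sum_comm]
      simp [mul_assoc, ← Finset.sum_mul, hLcol]
    simp [smul_mulVec, ← Finset.mul_sum, this]
  have hn0 : (n : ℝ) ≠ 0 := by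
    have : n ≠ 0 := by omega
    exact_mod_cast this
  set b : Fin m → ℝ := fun j => (∑ i, (p 0 (i, j) - peq (i, j))) / n with hb
  set pinf : Fin n × Fin m → ℝ := peq + fun il => b il.2 with hpinf
  have hMpinf : (astar • (L ⊗ₖ R)) *ᵥ pinf = Lbar *ᵥ pstar := by
    rw [hpinf, mulVec_add, hMpeq, hMconst, add_zero]
  have hr : ∀ t, HasDerivAt (fun t => p t - pinf) (-((astar • (L ⊗ₖ R)) *ᵥ (p t - pinf))) t := by
    intro t
    refine ((hp t).sub_const pinf).congr_deriv ?_
    rw [mulVec_sub, hMpinf, neg_sub, neg_add_eq_sub]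
  have hcons : ∀ t j, ∑ i, (p t - pinf) (i, j) = 0 := by
    intro t j
    have hder : ∀ t, HasDerivAt (fun t => ∑ i, (p t - pinf) (i, j)) 0 t := by
      intro t
      have h := HasDerivAt.fun_sum (u := Finset.univ)
        fun (i : Fin n) _ => hasDerivAt_pi.1 (hr t) (i, j)
      simpa only [Pi.neg_apply, Finset.sum_neg_distrib, hMsum, neg_zero] using h
    rw [is_const_of_deriv_eq_zero (fun t => (hder t).differentiableAt)
      (fun t => (hder t).deriv) t 0]
    simp only [hpinf, Pi.sub_apply, Pi.add_apply, ← sub_sub, Finset.sum_sub_distrib _ (fun _ => b j)]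
    simp only [hb, Finset.sum_const, Finset.card_univ, Fintype.card_fin, nsmul_eq_mul]
    field_simp
    ring
  have hlim : Tendsto p atTop (𝓝 pinf) := by
    have h := tendsto_zero_of_coercive (κ := astar * c / C) (by positivity) hr
      fun t => hcoer _ (hcons t)
    simpa using h.add_const pinf
  refine ⟨b, hlim, ?_⟩
  have hcont : Continuous fun q : Fin n × Fin m → ℝ =>
      -((astar • (L ⊗ₖ R)) *ᵥ q) + Lbar *ᵥ pstar :=
    ((continuous_const.matrix_mulVec continuous_id).neg).add continuous_const
  have h := (hcont.tendsto pinf).comp hlim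
  rw [hMpinf, neg_add_cancel] at h
  exact h
end
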